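/- arXiv:1712.01731 — 3 statements merged into one kernel-verified Lean document; each statement's English description precedes it below -/
import Mathlib

section
/- For every m ≥ 3 and n ≥ 2 there exist a finite set A with exactly n elements, an index set I, and for each t ∈ I a relation R_t ⊆ A^{k_t} with k_t ≤ m, such that some near-unanimity operation on A is compatible with R_t for every t ∈ I, but no near-unanimity operation on A of arity at most (m−1)^{2^{n−2}} is compatible with R_t for every t ∈ I. -/
/-- An operation `t : A^k → A` is a near-unanimity (NU) operation if `k ≥ 3` and
any tuple whose coordinates all equal `x` except possibly one coordinate (with
value `y`) is mapped to the majority value `x`. -/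
def IsNU {A : Type*} {k : ℕ} (t : (Fin k → A) → A) : Prop :=
  3 ≤ k ∧ ∀ (x y : A) (j : Fin k), t (Function.update (fun _ => x) j y) = x

/-- A `k`-ary operation `t` is compatible with (preserves) an `r`-ary relation `S`:
applying `t` coordinatewise to `k` tuples from `S` yields a tuple in `S`. -/
def Compat {A : Type*} {k r : ℕ} (t : (Fin k → A) → A) (S : Set (Fin r → A)) : Prop :=
  ∀ u : Fin k → Fin r → A, (∀ j, u j ∈ S) → (fun i => t fun j => u j i) ∈ S

/-- The universe of the example: `r` ordered bits together with the elements
`Sum.inr false` and `Sum.inr true`. -/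
abbrev BitElt (r : ℕ) : Type := Fin r ⊕ Bool

/-- The relation that starts the counter. -/
def startRel (r d : ℕ) : Set (Fin (d + 1) → BitElt r) :=
  {t | t 0 ≠ .inr false ∧ (t 0 = .inr true → ∃ s : Fin d, t s.succ ≠ .inr false)}

/-- The relation that trades the bit `p` for all the smaller bits. -/
def stepRel {r : ℕ} (d : ℕ) (p : Fin r) : Set (Fin (d + 1) → BitElt r) :=
  {t | (∃ q, p < q ∧ ∀ s, t s = .inl q) ∨
    ((∀ s : Fin d, t s.succ = .inr true ∨ t s.succ = .inl p) ∧
      ((∃ q < p, t 0 = .inl q) ∨ (t 0 = .inr true ∧ ∃ s : Fin d, t s.succ = .inr true)))}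

section LowerBound

open Finset

variable {r d k : ℕ}

lemma exists_fiber_card_le {α : Type*} [Fintype α] [DecidableEq α] (L : Finset α) {d c : ℕ}
    (hd : 0 < d) (h : #L ≤ d * c) : ∃ g : α → Fin d, ∀ s, #{j ∈ L | g j = s} ≤ c := by
  obtain ⟨φ⟩ : Nonempty (L ↪ Fin d × Fin c) :=
    Function.Embedding.nonempty_of_card_le (by simpa using h)
  refine ⟨fun j => if hj : j ∈ L then (φ ⟨j, hj⟩).1 else ⟨0, hd⟩, fun s => ?_⟩
  rcases Nat.eq_zero_or_pos c with rfl | hc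
  · have : L = ∅ := by simpa using h
    simp [this]
  have := Finset.card_le_card_of_injOn (t := (univ : Finset (Fin c)))
    (s := {j ∈ L | (if hj : j ∈ L then (φ ⟨j, hj⟩).1 else ⟨0, hd⟩) = s})
    (fun j => if hj : j ∈ L then (φ ⟨j, hj⟩).2 else ⟨0, hc⟩) (by simp) (by
      intro a ha b hb hab
      simp only [coe_filter, Set.mem_ofPred_eq] at ha hb
      obtain ⟨ha, ha'⟩ := ha
      obtain ⟨hb, hb'⟩ := hb
      simp only [ha, hb, dif_pos] at ha' hb' hab
      have := φ.injective (Prod.ext (ha'.trans hb'.symm) hab)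
      simpa using this)
  simpa using this

/-- `f` avoids the value `Sum.inr true` on tuples that have at most `c` entries `Sum.inr true`
and all their other entries in `Z`. -/
def Avoids (f : (Fin k → BitElt r) → BitElt r) (Z : Finset (Fin r)) (c : ℕ) : Prop :=
  ∀ y : Fin k → BitElt r, (∀ j, y j = .inr true ∨ ∃ q ∈ Z, y j = .inl q) →
    #{j | y j = .inr true} ≤ c → f y ≠ .inr true

lemma IsNU.apply_eq {A : Type*} [DecidableEq A] {f : (Fin k → A) → A} (hf : IsNU f)
    {a : A} {x : Fin k → A} (h : #{j | x j ≠ a} ≤ 1) : f x = a := by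
  obtain ⟨hk, hf⟩ := hf
  obtain ⟨j, hj⟩ : ∃ j, ∀ i, i ≠ j → x i = a := by
    rcases Finset.eq_empty_or_nonempty ({j | x j ≠ a} : Finset (Fin k)) with h0 | ⟨j, hj⟩
    · refine ⟨⟨0, by omega⟩, fun i _ => ?_⟩
      by_contra hi
      have : i ∈ ({j | x j ≠ a} : Finset (Fin k)) := by simpa using hi
      simp [h0] at this
    · refine ⟨j, fun i hij => ?_⟩
      by_contra hi
      exact hij (Finset.card_le_one.1 h i (by simpa using hi) j hj)
  have : x = Function.update (fun _ => a) j (x j) := by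
    funext i
    by_cases hij : i = j
    · subst hij; simp
    · simp [hij, hj i hij]
  rw [this]
  exact hf a (x j) j

lemma avoids_univ (hd : 0 < d) {f : (Fin k → BitElt r) → BitElt r} (hf : IsNU f)
    (hc : Compat f (startRel r d)) : Avoids f univ d := by
  intro y hy hcard hfy
  obtain ⟨g, hg⟩ := exists_fiber_card_le ({j | y j = .inr true} : Finset (Fin k))
    (c := 1) hd (by simpa using hcard)
  let x : Fin d → Fin k → BitElt r := fun s j =>
    if y j = .inr true ∧ g j = s then .inr true else .inr false
  have hx : ∀ s, f (x s) = .inr false := fun s => hf.apply_eq <| by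
    refine le_trans (card_le_card fun j => ?_) (hg s)
    simp only [x, mem_filter, mem_univ, true_and]
    split_ifs with h <;> simp [h]
  have := hc (fun j => Fin.cons (y j) fun s => x s j) fun j => by
    refine ⟨?_, fun h => ⟨g j, ?_⟩⟩
    · rcases hy j with h | ⟨q, -, h⟩ <;> simp [h]
    · simp only [Fin.cons_zero] at h
      simp [x, h]
  obtain ⟨s, hs⟩ := this.2 (by simpa using hfy)
  exact hs (by simpa using hx s)

lemma Avoids.step {f : (Fin k → BitElt r) → BitElt r} {p : Fin r} (hd : 0 < d)
    (hc : Compat f (stepRel d p)) {Z : Finset (Fin r)} (hZ : ∀ q ∈ Z, p < q) {c : ℕ}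
    (h : Avoids f (insert p Z) c) : Avoids f (Z ∪ Iio p) (d * c) := by
  intro y hy hcard hfy
  obtain ⟨g, hg⟩ := exists_fiber_card_le ({j | y j = .inr true} : Finset (Fin k)) hd hcard
  let x : Fin d → Fin k → BitElt r := fun s j => match y j with
    | .inl q => .inl (max p q)
    | .inr _ => if g j = s then .inr true else .inl p
  have hx : ∀ s, f (x s) ≠ .inr true := fun s => by
    refine h (x s) (fun j => ?_) (le_trans (card_le_card fun j => ?_) (hg s))
    · rcases hy j with h | ⟨q, hq, h⟩
      · by_cases hs : g j = s <;> simp [x, h, hs]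
      · rcases mem_union.1 hq with hq | hq
        · simp [x, h, max_eq_right (hZ q hq).le, hq]
        · simp [x, h, max_eq_left (mem_Iio.1 hq).le]
    · rcases hy j with h | ⟨q, hq, h⟩ <;> simp [x, h]
  have := hc (fun j => Fin.cons (y j) fun s => x s j) fun j => by
    rcases hy j with h | ⟨q, hq, h⟩
    · refine Or.inr ⟨fun s => ?_, Or.inr ⟨by simpa using h, g j, by simp [x, h]⟩⟩
      by_cases hs : g j = s <;> simp [x, h, hs]
    · rcases mem_union.1 hq with hq | hq
      · refine Or.inl ⟨q, hZ q hq, Fin.cases (by simpa using h) fun s => ?_⟩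
        simp [x, h, (hZ q hq).le]
      · rw [mem_Iio] at hq
        exact Or.inr ⟨fun s => by simp [x, h, hq.le], Or.inl ⟨q, hq, by simpa using h⟩⟩
  rcases this with ⟨q, -, hq⟩ | ⟨-, ⟨q, -, hq⟩ | ⟨-, s, hs⟩⟩
  · simpa [hfy] using hq 0
  · simp [hfy] at hq
  · exact hx s (by simpa using hs)

lemma Avoids.clear {f : (Fin k → BitElt r) → BitElt r} (hd : 0 < d)
    (hc : ∀ p, Compat f (stepRel d p)) (p : ℕ) (hp : p ≤ r) (Z : Finset (Fin r))
    (hZ : ∀ q ∈ Z, p ≤ (q : ℕ)) (c : ℕ) (h : Avoids f (Z ∪ ({q | (q : ℕ) < p} : Finset (Fin r))) c) :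
    Avoids f Z (d ^ (2 ^ p - 1) * c) := by
  induction p generalizing Z c with
  | zero => simpa using h
  | succ p ih =>
    let P : Fin r := ⟨p, hp⟩
    have hZ' : ∀ q ∈ Z, P < q := fun q hq => Fin.lt_def.2 (hZ q hq)
    have h₁ : Avoids f (insert P Z) (d ^ (2 ^ p - 1) * c) := by
      refine ih (by omega) _ ?_ c ?_
      · intro q hq
        rcases mem_insert.1 hq with rfl | hq
        · exact le_rfl
        · exact (hZ' q hq).le
      · convert h using 1
        ext q
        simp only [mem_union, mem_insert, mem_filter, mem_univ, true_and, P, Fin.ext_iff]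
        grind
    have h₂ := ih (by omega) Z (fun q hq => (hZ' q hq).le) _ (by
      convert h₁.step hd (hc P) hZ' using 1
      congr 1
      ext q
      simp [P, Fin.lt_def])
    convert h₂ using 1
    have : 2 ^ (p + 1) - 1 = (2 ^ p - 1) + 1 + (2 ^ p - 1) := by
      have := Nat.one_le_two_pow (n := p)
      omega
    rw [this]
    ring

lemma lt_of_isNU_of_compat {f : (Fin k → BitElt r) → BitElt r} (hd : 0 < d) (hf : IsNU f)
    (hstart : Compat f (startRel r d)) (hstep : ∀ p, Compat f (stepRel d p)) :
    d ^ 2 ^ r < k := by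
  by_contra! hk
  refine Avoids.clear hd hstep r le_rfl ∅ (by simp) d ?_ (fun _ => .inr true) (by simp) ?_
    (hf.apply_eq (by simp))
  · convert avoids_univ hd hf hstart
    ext q
    simp
  · have : d ^ (2 ^ r - 1) * d = d ^ 2 ^ r := by
      rw [← pow_succ, Nat.sub_add_cancel Nat.one_le_two_pow]
    simpa [this] using hk

end LowerBound

section Construction

open Finset

variable {r d k : ℕ}

/-- The number whose binary digits are given by `Z`. -/
def weight (Z : Finset (Fin r)) : ℕ := ∑ q ∈ Z, 2 ^ (q : ℕ)

lemma weight_lt {Z : Finset (Fin r)} {p : ℕ} (h : ∀ q ∈ Z, (q : ℕ) < p) : weight Z < 2 ^ p := by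
  have := Nat.geomSum_lt (m := 2) (n := p) (s := Z.map Fin.valEmbedding) le_rfl (by simpa using h)
  simpa [weight] using this

/-- The number of exceptional coordinates tolerated by a set `Z` of bits. -/
def tolerance (d : ℕ) (Z : Finset (Fin r)) : ℕ := d ^ (2 ^ r - weight Z)

lemma tolerance_pos (hd : 0 < d) (Z : Finset (Fin r)) : 0 < tolerance d Z := Nat.pow_pos hd

lemma tolerance_le (hd : 0 < d) (Z : Finset (Fin r)) : tolerance d Z ≤ d ^ 2 ^ r :=
  Nat.pow_le_pow_right hd (Nat.sub_le _ _)

lemma le_tolerance (hd : 0 < d) (Z : Finset (Fin r)) : d ≤ tolerance d Z := by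
  have := weight_lt (Z := Z) fun q _ => q.2
  simpa [tolerance] using Nat.pow_le_pow_right hd (show 1 ≤ 2 ^ r - weight Z by omega)

lemma mul_tolerance_le (hd : 0 < d) {W Z : Finset (Fin r)} (h : weight W < weight Z) :
    d * tolerance d Z ≤ tolerance d W := by
  have := weight_lt (Z := Z) fun q _ => q.2
  rw [tolerance, ← pow_succ']
  exact Nat.pow_le_pow_right hd (by omega)

lemma weight_lt_weight {W Z : Finset (Fin r)} (h : W ⊂ Z) : weight W < weight Z := by
  obtain ⟨q, hq, hqW⟩ := exists_of_ssubset h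
  exact sum_lt_sum_of_subset h.subset hq hqW (by positivity) fun _ _ _ => Nat.zero_le _

lemma tolerance_mono (hd : 0 < d) {W Z : Finset (Fin r)} (h : W ⊆ Z) :
    tolerance d Z ≤ tolerance d W :=
  Nat.pow_le_pow_right hd (Nat.sub_le_sub_left (sum_le_sum_of_subset h) _)

lemma weight_erase_union_Iio_lt {Z : Finset (Fin r)} {p : Fin r} (hp : p ∈ Z) :
    weight (Z.erase p ∪ Iio p) < weight Z := by
  have h₁ : weight (Iio p) < 2 ^ (p : ℕ) := weight_lt fun q hq => Fin.lt_def.1 (mem_Iio.1 hq)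
  have h₂ : weight (Z.erase p) + 2 ^ (p : ℕ) = weight Z := sum_erase_add _ _ hp
  have h₃ : weight (Z.erase p ∪ Iio p) ≤ weight (Z.erase p) + weight (Iio p) := by
    have := sum_union_inter (s₁ := Z.erase p) (s₂ := Iio p) (f := fun q : Fin r => 2 ^ (q : ℕ))
    unfold weight
    omega
  omega

/-- The coordinates where the value of `x` is not a bit in `Z`. -/
def outside (x : Fin k → BitElt r) (Z : Finset (Fin r)) : Finset (Fin k) :=
  {j | ∀ q ∈ Z, x j ≠ .inl q}

lemma mem_outside {x : Fin k → BitElt r} {Z : Finset (Fin r)} {j : Fin k} :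
    j ∈ outside x Z ↔ ∀ q ∈ Z, x j ≠ .inl q := by simp [outside]

/-- `Z` contains almost all values of `x`. -/
def Dominates (d : ℕ) (Z : Finset (Fin r)) (x : Fin k → BitElt r) : Prop :=
  #(outside x Z) ≤ tolerance d Z

lemma Dominates.of_subset {Z W : Finset (Fin r)} {x y : Fin k → BitElt r} (hd : 0 < d)
    (h : Dominates d Z x) (hWZ : W ⊆ Z) (hsub : outside y W ⊆ outside x Z) : Dominates d W y :=
  (card_le_card hsub).trans (h.trans (tolerance_mono hd hWZ))

lemma Dominates.nonempty {Z : Finset (Fin r)} {x : Fin k → BitElt r} (hk : d ^ 2 ^ r < k)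
    (h : Dominates d Z x) : Z.Nonempty := by
  rw [nonempty_iff_ne_empty]
  rintro rfl
  simp only [Dominates, outside, tolerance, weight] at h
  simp at h
  omega

lemma exists_isLeast_dominates (hd : 2 ≤ d) {x : Fin k → BitElt r}
    (h : ∃ Z, Dominates d Z x) : ∃ Z, IsLeast {Z | Dominates d Z x} Z := by
  classical
  obtain ⟨Z, hZ, hmin⟩ := exists_min_image ({Z | Dominates d Z x} : Finset (Finset (Fin r)))
    weight (by obtain ⟨Z, hZ⟩ := h; exact ⟨Z, by simpa using hZ⟩)
  simp only [mem_filter, mem_univ, true_and] at hZ hmin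
  refine ⟨Z, hZ, fun W hW => ?_⟩
  by_contra hsub
  have hlt : weight (Z ∩ W) < weight Z := weight_lt_weight
    ⟨inter_subset_left, fun hle => hsub (hle.trans inter_subset_right)⟩
  have hWZ : tolerance d W ≤ tolerance d Z :=
    Nat.pow_le_pow_right (by omega) (Nat.sub_le_sub_left (hmin W hW) _)
  refine absurd (hmin (Z ∩ W) ?_) (not_le.2 hlt)
  have hsub' : outside x (Z ∩ W) ⊆ outside x Z ∪ outside x W := fun j hj => by
    by_contra hj'
    simp only [mem_union, mem_outside, not_or, not_forall, not_not] at hj'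
    obtain ⟨⟨q, hq, h₁⟩, q', hq', h₂⟩ := hj'
    obtain rfl : q = q' := Sum.inl_injective (h₁.symm.trans h₂)
    exact mem_outside.1 hj q (mem_inter.2 ⟨hq, hq'⟩) h₁
  calc #(outside x (Z ∩ W)) ≤ #(outside x Z) + #(outside x W) :=
        (card_le_card hsub').trans (card_union_le _ _)
    _ ≤ tolerance d Z + tolerance d W := add_le_add hZ hW
    _ ≤ 2 * tolerance d Z := by omega
    _ ≤ d * tolerance d Z := Nat.mul_le_mul_right _ hd
    _ ≤ tolerance d (Z ∩ W) := mul_tolerance_le (by omega) hlt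

/-- `v` is the value prescribed at a tuple `x` of elements other than `Sum.inr false`: the least
bit of the least dominating set, or `Sum.inr true` if there is none. -/
def IsMainValue (d : ℕ) (x : Fin k → BitElt r) (v : BitElt r) : Prop :=
  (v = .inr true ∧ ∀ Z, ¬ Dominates d Z x) ∨
    ∃ Z q, IsLeast {Z | Dominates d Z x} Z ∧ IsLeast (Z : Set (Fin r)) q ∧ v = .inl q

lemma exists_isMainValue (hd : 2 ≤ d) (hk : d ^ 2 ^ r < k) (x : Fin k → BitElt r) :
    ∃ v, IsMainValue d x v := by
  by_cases h : ∃ Z, Dominates d Z x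
  · obtain ⟨Z, hZ⟩ := exists_isLeast_dominates hd h
    exact ⟨_, Or.inr ⟨Z, _, hZ, Z.isLeast_min' (hZ.1.nonempty hk), rfl⟩⟩
  · exact ⟨_, Or.inl ⟨rfl, not_exists.1 h⟩⟩

lemma IsMainValue.exists_isLeast {x : Fin k → BitElt r} {v : BitElt r} (h : IsMainValue d x v)
    (hv : v ≠ .inr true) :
    ∃ Z q, IsLeast {Z | Dominates d Z x} Z ∧ IsLeast (Z : Set (Fin r)) q ∧ v = .inl q :=
  h.resolve_left fun h => hv h.1

lemma IsMainValue.ne_true {x : Fin k → BitElt r} {v : BitElt r} (h : IsMainValue d x v)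
    {Z : Finset (Fin r)} (hZ : Dominates d Z x) : v ≠ .inr true := by
  rcases h with ⟨-, h⟩ | ⟨_, _, -, -, rfl⟩
  · exact absurd hZ (h Z)
  · simp

lemma IsMainValue.eq_of_card_le_one (hd : 0 < d) (hk : d ^ 2 ^ r + 1 < k)
    {x : Fin k → BitElt r} {v a : BitElt r} (h : IsMainValue d x v) (ha : a ≠ .inr false)
    (hx : #{j | x j ≠ a} ≤ 1) : v = a := by
  rcases a with q | b
  · have hq : Dominates d {q} x := by
      refine le_trans ?_ (tolerance_pos hd {q})
      simpa [outside] using hx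
    obtain ⟨Z, p, hZ, hp, rfl⟩ := h.exists_isLeast (h.ne_true hq)
    rw [mem_singleton.1 (hZ.2 hq hp.1)]
  · obtain rfl : b = true := by simpa using ha
    rcases h with ⟨rfl, -⟩ | ⟨Z, -, hZ, -⟩
    · rfl
    have hsub : ({j | x j = .inr true} : Finset (Fin k)) ⊆ outside x Z := fun j hj => by
      rw [mem_outside]
      intro q _
      simp [(mem_filter.1 hj).2]
    have h₁ := (card_le_card hsub).trans (hZ.1.trans (tolerance_le hd Z))
    have h₂ := card_filter_add_card_filter_not (s := (univ : Finset (Fin k)))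
      (fun j => x j = .inr true)
    simp only [card_univ, Fintype.card_fin] at h₂
    simp only [ne_eq] at hx
    omega

lemma IsMainValue.mem_stepRel (hd : 0 < d) (p : Fin r)
    {u : Fin k → Fin (d + 1) → BitElt r} (hu : ∀ j, u j ∈ stepRel d p)
    {v : Fin (d + 1) → BitElt r} (hv : ∀ i, IsMainValue d (fun j => u j i) (v i)) :
    v ∈ stepRel d p := by
  have hp0 : ∀ j, u j 0 ≠ .inl p := by
    intro j h
    rcases hu j with ⟨q, hq, h'⟩ | ⟨-, ⟨q, hq, h'⟩ | ⟨h', -⟩⟩ <;> rw [h'] at h <;>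
      simp at h <;> simp [h] at hq
  have hge : ∀ (s : Fin d) Z, IsLeast {Z | Dominates d Z fun j => u j s.succ} Z →
      ∀ q ∈ Z, p ≤ q := by
    intro s Z hZ q hq
    refine (mem_filter.1 (hZ.2 (show Dominates d ({q ∈ Z | p ≤ q}) _ from
      hZ.1.of_subset hd (filter_subset _ _) fun j hj => ?_) hq)).2
    simp only [mem_outside, mem_filter] at hj ⊢
    intro q' hq' h
    refine hj q' ⟨hq', ?_⟩ h
    rcases hu j with ⟨t, ht, h'⟩ | ⟨h', -⟩
    · rw [h'] at h
      simp at h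
      exact h ▸ ht.le
    · rcases h' s with h' | h' <;> rw [h'] at h <;> simp at h
      exact h.le
  have hdown : ∀ (s : Fin d) Z, IsLeast {Z | Dominates d Z fun j => u j s.succ} Z → p ∉ Z →
      Dominates d Z fun j => u j 0 := by
    intro s Z hZ hpZ
    refine hZ.1.of_subset hd subset_rfl fun j hj => ?_
    simp only [mem_outside] at hj ⊢
    intro q hq h
    rcases hu j with ⟨t, ht, h'⟩ | ⟨h', -⟩
    · rw [h'] at h
      exact hj q hq (by rw [h', h])
    · rcases h' s with h' | h' <;> rw [h'] at h <;> simp at h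
      exact hpZ (h ▸ hq)
  have hside : (v 0 = .inr true ∨ ∃ q < p, v 0 = .inl q) →
      ∀ s : Fin d, v s.succ = .inr true ∨ v s.succ = .inl p := by
    intro h0 s
    by_contra! hs
    obtain ⟨Z, q, hZ, hq, hvs⟩ := (hv s.succ).exists_isLeast hs.1
    by_cases hpZ : p ∈ Z
    · exact hs.2 (by rw [hvs, le_antisymm (hq.2 hpZ) (hge s Z hZ q hq.1)])
    · have hdom := hdown s Z hZ hpZ
      obtain ⟨W, t, hW, ht, hv0⟩ := (hv 0).exists_isLeast ((hv 0).ne_true hdom)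
      have htp : p ≤ t := hge s Z hZ t (hW.2 hdom ht.1)
      rcases h0 with h0 | ⟨t', ht', h0⟩ <;> rw [hv0] at h0 <;> simp at h0
      omega
  by_cases h0 : v 0 = .inr true
  · refine Or.inr ⟨hside (Or.inl h0), Or.inr ⟨h0, ?_⟩⟩
    by_contra! hs
    choose Z q hZ hq hvs using fun s => (hv (Fin.succ s)).exists_isLeast (hs s)
    by_cases hpZ : ∃ s, p ∉ Z s
    · obtain ⟨s, hpZ⟩ := hpZ
      exact (hv 0).ne_true (hdown s _ (hZ s) hpZ) h0
    push Not at hpZ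
    obtain ⟨s, -, hmax⟩ := exists_max_image (univ : Finset (Fin d)) (fun s => tolerance d (Z s))
      ⟨⟨0, hd⟩, mem_univ _⟩
    refine (hv 0).ne_true (Z := (Z s).erase p ∪ Iio p) ?_ h0
    have hsub : outside (fun j => u j 0) ((Z s).erase p ∪ Iio p) ⊆
        univ.biUnion fun s => outside (fun j => u j s.succ) (Z s) := by
      intro j hj
      simp only [mem_outside, mem_union, mem_erase, mem_Iio] at hj
      simp only [mem_biUnion, mem_univ, true_and, mem_outside]
      rcases hu j with ⟨t, ht, h'⟩ | ⟨-, ⟨t, ht, h'⟩ | ⟨-, s', h'⟩⟩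
      · refine ⟨s, fun t' ht' h => ?_⟩
        rw [h'] at h
        simp at h
        subst h
        exact hj t (Or.inl ⟨ht.ne', ht'⟩) (h' 0)
      · exact absurd h' (hj t (Or.inr ht))
      · exact ⟨s', by simp [h']⟩
    calc #(outside (fun j => u j 0) ((Z s).erase p ∪ Iio p))
        ≤ ∑ s, #(outside (fun j => u j (Fin.succ s)) (Z s)) :=
          (card_le_card hsub).trans card_biUnion_le
      _ ≤ ∑ _s : Fin d, tolerance d (Z s) :=
          sum_le_sum fun s' hs' => (hZ s').1.trans (hmax s' hs')
      _ = d * tolerance d (Z s) := by simp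
      _ ≤ _ := mul_tolerance_le hd (weight_erase_union_Iio_lt (hpZ s))
  obtain ⟨W, q, hW, hq, hv0⟩ := (hv 0).exists_isLeast h0
  have hpW : p ∉ W := fun hpW => by
    refine notMem_erase p W (hW.2 (show Dominates d (W.erase p) _ from
      hW.1.of_subset hd (erase_subset _ _) fun j hj => ?_) hpW)
    simp only [mem_outside, mem_erase] at hj ⊢
    intro t ht h
    exact hj t ⟨fun htp => hp0 j (htp ▸ h), ht⟩ h
  rcases lt_trichotomy q p with hqp | rfl | hqp
  · exact Or.inr ⟨hside (Or.inr ⟨q, hqp, hv0⟩), Or.inl ⟨q, hqp, hv0⟩⟩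
  · exact absurd hq.1 hpW
  · refine Or.inl ⟨q, hqp, Fin.cases hv0 fun s => ?_⟩
    have hdom : Dominates d W fun j => u j s.succ := by
      refine hW.1.of_subset hd subset_rfl fun j hj => ?_
      simp only [mem_outside] at hj ⊢
      intro t ht h
      have htp : p < t := hqp.trans_le (hq.2 ht)
      rcases hu j with ⟨t', ht', h'⟩ | ⟨-, ⟨t', ht', h'⟩ | ⟨h', -⟩⟩
      · rw [h'] at h
        exact hj t ht (by rw [h', h])
      · rw [h'] at h
        simp at h
        omega
      · rw [h'] at h
        simp at h
    obtain ⟨Z, t, hZ, ht, hvs⟩ := (hv s.succ).exists_isLeast ((hv s.succ).ne_true hdom)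
    have hZW : Z ⊆ W := hZ.2 hdom
    have hWZ : W ⊆ Z := hW.2 (hdown s Z hZ fun h => hpW (hZW h))
    obtain rfl : Z = W := hZW.antisymm hWZ
    rw [hvs, ht.unique hq]

/-- `v` is the value prescribed at an arbitrary tuple `x`. -/
def IsValue (d : ℕ) (x : Fin k → BitElt r) (v : BitElt r) : Prop :=
  (∀ a, #{j | x j ≠ a} ≤ 1 → v = a) ∧ (v = .inr false → #{j | x j ≠ .inr false} ≤ 1) ∧
    ((∀ j, x j ≠ .inr false) → IsMainValue d x v)

lemma eq_of_card_ne_le_one {A : Type*} [DecidableEq A] (hk : 3 ≤ k) {x : Fin k → A} {a b : A}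
    (ha : #{j | x j ≠ a} ≤ 1) (hb : #{j | x j ≠ b} ≤ 1) : a = b := by
  by_contra hab
  have hsub : (univ : Finset (Fin k)) ⊆
      ({j | x j ≠ a} : Finset (Fin k)) ∪ ({j | x j ≠ b} : Finset (Fin k)) := fun j _ => by
    simp only [mem_union, mem_filter, mem_univ, true_and]
    by_contra! h
    exact hab (h.1.symm.trans h.2)
  have := (card_le_card hsub).trans (card_union_le _ _)
  simp only [card_univ, Fintype.card_fin] at this
  omega

lemma exists_isValue (hd : 2 ≤ d) (hk : d ^ 2 ^ r + 1 < k) (hk3 : 3 ≤ k)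
    (x : Fin k → BitElt r) : ∃ v, IsValue d x v := by
  by_cases hx : ∀ j, x j ≠ .inr false
  · obtain ⟨v, hv⟩ := exists_isMainValue hd (by omega) x
    refine ⟨v, fun a ha => hv.eq_of_card_le_one (by omega) hk ?_ ha, ?_, fun _ => hv⟩
    · rintro rfl
      simp [hx] at ha
      omega
    · rintro rfl
      rcases hv with ⟨h, -⟩ | ⟨_, _, _, _, h⟩ <;> simp at h
  by_cases ha : ∃ a, #{j | x j ≠ a} ≤ 1
  · obtain ⟨a, ha⟩ := ha
    exact ⟨a, fun b hb => eq_of_card_ne_le_one hk3 ha hb, by rintro rfl; exact ha,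
      fun h => absurd h hx⟩
  · exact ⟨.inr true, fun a h => absurd ⟨a, h⟩ ha, by simp, fun h => absurd h hx⟩

lemma exists_isNU_compat (r : ℕ) (hd : 2 ≤ d) :
    ∃ (k : ℕ) (f : (Fin k → BitElt r) → BitElt r), IsNU f ∧ Compat f (startRel r d) ∧
      ∀ p, Compat f (stepRel d p) := by
  choose f hf using exists_isValue (r := r) (k := d ^ 2 ^ r + 3) hd (by omega) (by omega)
  refine ⟨_, f, ⟨by omega, fun a b j => (hf _).1 a ?_⟩, fun u hu => ?_, fun p u hu => ?_⟩
  · refine Finset.card_le_one.2 fun i hi i' hi' => ?_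
    have key : ∀ i, Function.update (fun _ => a) j b i ≠ a → i = j := fun i h => by
      by_contra hij
      simp [hij] at h
    rw [key i (mem_filter.1 hi).2, key i' (mem_filter.1 hi').2]
  · have hmain := (hf fun j => u j 0).2.2 fun j => (hu j).1
    refine ⟨?_, fun h0 => ?_⟩
    · rcases hmain with ⟨h, -⟩ | ⟨_, _, _, _, h⟩ <;> simp [h]
    by_contra! hs
    refine hmain.ne_true (Z := univ) ?_ h0
    have hsub : outside (fun j => u j 0) univ ⊆
        univ.biUnion fun s : Fin d => {j | u j s.succ ≠ .inr false} := by
      intro j hj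
      simp only [mem_outside, mem_univ, true_imp_iff] at hj
      obtain ⟨h₁, h₂⟩ := hu j
      rcases h : u j 0 with q | b
      · exact absurd h (hj q)
      · cases b
        · exact absurd h h₁
        · simpa using h₂ h
    calc _ ≤ ∑ s : Fin d, #{j | u j s.succ ≠ .inr false} :=
          (card_le_card hsub).trans card_biUnion_le
      _ ≤ ∑ _s : Fin d, 1 := sum_le_sum fun s _ => (hf _).2.1 (hs s)
      _ = d := by simp
      _ ≤ _ := le_tolerance (by omega) _
  · refine IsMainValue.mem_stepRel (by omega) p hu fun i => (hf _).2.2 fun j => ?_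
    rcases hu j with ⟨q, -, h⟩ | ⟨h, h0⟩
    · simp [h]
    · refine Fin.cases ?_ (fun s => ?_) i
      · rcases h0 with ⟨q, -, h⟩ | ⟨h, -⟩ <;> simp [h]
      · rcases h s with h | h <;> simp [h]

end Construction

/-- For every `m ≥ 3` and `n ≥ 2` there is a relational structure on an `n`-element
set with relations of arity at most `m` that admits an NU polymorphism but none of
arity `≤ (m-1)^(2^(n-2))`. -/
theorem stmt0 (m n : ℕ) (hm : 3 ≤ m) (hn : 2 ≤ n) :
    ∃ (A : Type) (inst : Fintype A) (I : Type) (r : I → ℕ)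
      (R : (i : I) → Set (Fin (r i) → A)),
      @Fintype.card A inst = n ∧ (∀ i, r i ≤ m) ∧
      (∃ (k : ℕ) (f : (Fin k → A) → A), IsNU f ∧ ∀ i, Compat f (R i)) ∧
      (∀ (k : ℕ) (f : (Fin k → A) → A), k ≤ (m - 1) ^ 2 ^ (n - 2) → IsNU f →
        ¬ (∀ i, Compat f (R i))) := by
  obtain ⟨d, rfl⟩ : ∃ d, m = d + 1 := ⟨m - 1, by omega⟩
  obtain ⟨r, rfl⟩ : ∃ r, n = r + 2 := ⟨n - 2, by omega⟩
  refine ⟨BitElt r, inferInstance, Option (Fin r), fun _ => d + 1,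
    fun i => i.elim (startRel r d) (stepRel d), by simp, fun _ => le_rfl, ?_, ?_⟩
  · obtain ⟨k, f, hf, hstart, hstep⟩ := exists_isNU_compat r (d := d) (by omega)
    exact ⟨k, f, hf, fun i => i.casesOn hstart hstep⟩
  · intro k f hk hf hc
    exact absurd (lt_of_isNU_of_compat (by omega) hf (hc none) fun p => hc (some p))
      (not_lt.2 (by simpa using hk))
end

section
/- For every n ≥ 3 there exist a finite set A with exactly n elements, an index set I, and for each t ∈ I a relation R_t ⊆ A^{k_t} with k_t ≤ 2, such that some near-unanimity operation on A is compatible with R_t for every t ∈ I, but no near-unanimity operation on A of arity at most 2^{2^{n−3}} is compatible with R_t for every t ∈ I. -/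
namespace NUCounter

open Finset

variable {m k : ℕ}

/-- The number whose binary digits are given by `S`. -/
def binVal (S : Finset (Fin m)) : ℕ := ∑ i ∈ S, 2 ^ (i : ℕ)

/-- The number of exceptional coordinates tolerated by `S`. -/
def tolerance (S : Finset (Fin m)) : ℕ := 2 ^ binVal Sᶜ

/-- One step of the binary counter: digit `i` is replaced by all smaller digits. -/
def decr (S : Finset (Fin m)) (i : Fin m) : Finset (Fin m) := S.erase i ∪ Finset.Iio i

lemma binVal_mono {S T : Finset (Fin m)} (h : S ⊆ T) : binVal S ≤ binVal T :=
  Finset.sum_le_sum_of_subset h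

lemma binVal_lt {S T : Finset (Fin m)} (h : S ⊂ T) : binVal S < binVal T := by
  obtain ⟨i, hi, hiS⟩ := Finset.exists_of_ssubset h
  exact Finset.sum_lt_sum_of_subset h.1 hi hiS (by positivity) (fun _ _ _ => Nat.zero_le _)

lemma binVal_Iio (i : Fin m) : binVal (Finset.Iio i) + 1 = 2 ^ (i : ℕ) := by
  have h : binVal (Finset.Iio i) = ∑ j ∈ Finset.range i, 2 ^ j := by
    rw [binVal, ← Nat.Iio_eq_range, ← Fin.map_valEmbedding_Iio, Finset.sum_map]
    rfl
  rw [h, Nat.geomSum_eq le_rfl]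
  have := Nat.one_le_two_pow (n := i)
  simp only [Nat.add_one_sub_one, Nat.div_one]
  omega

lemma binVal_decr {S : Finset (Fin m)} {i : Fin m} (hi : i ∈ S) (hmin : ∀ j ∈ S, i ≤ j) :
    binVal (decr S i) + 1 = binVal S := by
  have hd : Disjoint (S.erase i) (Finset.Iio i) := by
    rw [Finset.disjoint_left]
    intro j hj hj'
    exact absurd (hmin j (Finset.mem_of_mem_erase hj)) (not_le.2 (Finset.mem_Iio.1 hj'))
  have h1 : binVal (decr S i) = binVal (S.erase i) + binVal (Finset.Iio i) :=
    Finset.sum_union hd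
  have h2 : binVal (S.erase i) + 2 ^ (i : ℕ) = binVal S :=
    Finset.sum_erase_add S (fun j : Fin m => 2 ^ (j : ℕ)) hi
  rw [h1, add_assoc, binVal_Iio, h2]

lemma two_mul_tolerance_le {S T : Finset (Fin m)} (h : binVal S < binVal T) :
    2 * tolerance T ≤ tolerance S := by
  have hS : binVal S + binVal Sᶜ = binVal univ :=
    Finset.sum_add_sum_compl S fun j : Fin m => 2 ^ (j : ℕ)
  have hT : binVal T + binVal Tᶜ = binVal univ :=
    Finset.sum_add_sum_compl T fun j : Fin m => 2 ^ (j : ℕ)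
  rw [tolerance, tolerance, ← pow_succ']
  exact Nat.pow_le_pow_right two_pos (by omega)

lemma tolerance_anti {S T : Finset (Fin m)} (h : S ⊆ T) : tolerance T ≤ tolerance S :=
  Nat.pow_le_pow_right two_pos (binVal_mono (Finset.compl_subset_compl.2 h))

lemma one_le_tolerance (S : Finset (Fin m)) : 1 ≤ tolerance S := Nat.one_le_two_pow

/-- The binary relations of the structure. -/
def Step (i : Fin m) (b : Bool) (x y : Fin m ⊕ Bool) : Prop :=
  (∃ e, i < e ∧ x = .inl e ∧ y = .inl e) ∨
  (x = .inl i ∧ ((∃ j, j < i ∧ y = .inl j) ∨ y = .inr b)) ∨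
  ((∃ c, x = .inr c) ∧ ((∃ j, j < i ∧ y = .inl j) ∨ ∃ c, y = .inr c))

/-- The structure on `Fin m ⊕ Bool` whose relations are all the `Step i b`. -/
def stepRel (p : Fin m × Bool) : Set (Fin 2 → Fin m ⊕ Bool) :=
  {u | Step p.1 p.2 (u 0) (u 1)}

section LowerBound

variable {f : (Fin k → Fin m ⊕ Bool) → Fin m ⊕ Bool}

lemma step_apply (hf : ∀ p, Compat f (stepRel p)) {i : Fin m} {b : Bool}
    {x y : Fin k → Fin m ⊕ Bool} (h : ∀ j, Step i b (x j) (y j)) : Step i b (f x) (f y) := by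
  simpa [stepRel] using hf (i, b) (fun j => ![x j, y j]) (fun j => by simpa [stepRel] using h j)

/-- However the coordinates outside `J` are chosen in `S`, some choice of the coordinates in `J`
outside `Fin m` makes the value of `f` lie in `S`. -/
def Absorbs (f : (Fin k → Fin m ⊕ Bool) → Fin m ⊕ Bool) (S : Finset (Fin m))
    (J : Finset (Fin k)) : Prop :=
  ∀ z : Fin k → Fin m, (∀ j ∉ J, z j ∈ S) →
    ∃ c : Fin k → Bool, ∃ e ∈ S, f (fun j => if j ∈ J then .inr (c j) else .inl (z j)) = .inl e

lemma Absorbs.decr (hf : ∀ p, Compat f (stepRel p)) {S : Finset (Fin m)} {i : Fin m}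
    (hi : i ∈ S) (hmin : ∀ j ∈ S, i ≤ j) {J₁ J₂ : Finset (Fin k)} (hJ : Disjoint J₁ J₂)
    (h₁ : Absorbs f S J₁) (h₂ : Absorbs f S J₂) : Absorbs f (decr S i) (J₁ ∪ J₂) := by
  intro z hz
  have key : ∀ (b : Bool) (J J' : Finset (Fin k)), Disjoint J J' → J ∪ J' = J₁ ∪ J₂ →
      Absorbs f S J → (∀ j ∈ J', (decide (j ∈ J₂)) = b) →
      ∃ e ∈ S, Step i b (.inl e)
        (f fun j => if j ∈ J₁ ∪ J₂ then .inr (decide (j ∈ J₂)) else .inl (z j)) := by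
    intro b J J' hd hu hA hb
    obtain ⟨c, e, he, hfe⟩ := hA
      (fun j => if j ∈ J' then i else if z j < i then i else z j) (by
        intro j hj
        split_ifs with h1 h2
        · exact hi
        · exact hi
        · have := hz j (by rw [← hu, Finset.mem_union]; tauto)
          simp only [NUCounter.decr, Finset.mem_union, Finset.mem_Iio] at this
          exact Finset.mem_of_mem_erase (this.resolve_right h2))
    refine ⟨e, he, ?_⟩
    rw [← hfe]
    apply step_apply hf
    intro j
    rw [← hu]
    by_cases hj : j ∈ J
    · right; right
      simp [hj]
    · by_cases hj' : j ∈ J'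
      · right; left
        simp [hj, hj', hb j hj']
      · have := hz j (by rw [← hu, Finset.mem_union]; tauto)
        simp only [NUCounter.decr, Finset.mem_union, Finset.mem_Iio, Finset.mem_erase] at this
        by_cases hlt : z j < i
        · right; left
          simp [hj, hj', hlt]
        · left
          have h := this.resolve_right hlt
          exact ⟨z j, lt_of_le_of_ne (hmin _ h.2) (Ne.symm h.1), by simp [hj, hj', hlt],
            by simp [hj, hj']⟩
  refine ⟨fun j => decide (j ∈ J₂), ?_⟩
  obtain ⟨e, he, h⟩ := key true J₁ J₂ hJ rfl h₁ (fun j hj => by simpa using hj)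
  obtain ⟨e', he', h'⟩ := key false J₂ J₁ hJ.symm (Finset.union_comm _ _) h₂
    (fun j hj => by simpa using Finset.disjoint_left.1 hJ hj)
  generalize f _ = y at h h'
  simp only [Step, NUCounter.decr, Finset.mem_union, Finset.mem_Iio, Finset.mem_erase] at h h' ⊢
  rcases h with ⟨a, ha, hea, rfl⟩ | ⟨-, ⟨a, ha, rfl⟩ | rfl⟩ | ⟨⟨c, hc⟩, -⟩
  · cases hea
    exact ⟨e, .inl ⟨ha.ne', he⟩, rfl⟩
  · exact ⟨a, .inr ha, rfl⟩
  · simp at h'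
  · simp at hc

lemma exists_absorbs (hm : 0 < m) (hNU : IsNU f) (hf : ∀ p, Compat f (stepRel p)) (t : ℕ)
    (ht : t ≤ 2 ^ (m - 1)) :
    ∃ S : Finset (Fin m), binVal S + t = 2 ^ (m - 1) ∧
      ∀ J : Finset (Fin k), #J ≤ 2 ^ t → Absorbs f S J := by
  induction t with
  | zero =>
    let a : Fin m := ⟨m - 1, by omega⟩
    refine ⟨{a}, by simp [binVal, a], fun J hJ z hz => ⟨fun _ => true, a, by simp, ?_⟩⟩
    have hk : 0 < k := by have := hNU.1; omega
    obtain ⟨j₀, hj₀⟩ : ∃ j₀ : Fin k, J ⊆ {j₀} := by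
      have : Nonempty (Fin k) := ⟨⟨0, hk⟩⟩
      exact Finset.card_le_one_iff_subset_singleton.1 (by simpa using hJ)
    convert hNU.2 (.inl a) (if j₀ ∈ J then .inr true else .inl a) j₀ using 2
    funext j
    by_cases hj : j = j₀
    · subst hj
      by_cases h : j ∈ J
      · simp [h]
      · simpa [h] using hz j h
    · have h : j ∉ J := fun h => hj (by simpa using hj₀ h)
      simpa [h, hj] using hz j h
  | succ t ih =>
    obtain ⟨S, hS, hA⟩ := ih (by omega)
    have hne : S.Nonempty := by
      rw [Finset.nonempty_iff_ne_empty]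
      rintro rfl
      simp only [binVal, Finset.sum_empty] at hS
      omega
    have hmin : ∀ j ∈ S, S.min' hne ≤ j := fun j hj => S.min'_le j hj
    have hdec := binVal_decr (S.min'_mem hne) hmin
    refine ⟨NUCounter.decr S (S.min' hne), by omega, fun J hJ => ?_⟩
    obtain ⟨J₁, hJ₁, hc⟩ := Finset.exists_subset_card_eq (s := J) (n := #J / 2) (by omega)
    have hcard := Finset.card_sdiff_add_card_eq_card hJ₁
    rw [pow_succ] at hJ
    rw [← Finset.union_sdiff_of_subset hJ₁]
    exact Absorbs.decr hf (S.min'_mem hne) hmin Finset.disjoint_sdiff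
      (hA _ (by omega)) (hA _ (by omega))

lemma not_compat_of_le (hm : 0 < m) (hk : k ≤ 2 ^ 2 ^ (m - 1)) (hNU : IsNU f) :
    ¬ ∀ p, Compat f (stepRel p) := by
  intro hf
  obtain ⟨S, hS, hA⟩ := exists_absorbs hm hNU hf _ le_rfl
  obtain ⟨-, e, he, -⟩ := hA univ (by simpa using hk) (fun _ => ⟨0, hm⟩) (by simp)
  have hpos : 0 < binVal S := Finset.sum_pos (fun _ _ => by positivity) ⟨e, he⟩
  omega

end LowerBound

section Construction

/-- The number of coordinates of `x` outside `S`. -/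
def outs (S : Finset (Fin m)) (x : Fin k → Fin m ⊕ Bool) : ℕ :=
  #{j | ∀ s ∈ S, x j ≠ .inl s}

/-- The number of coordinates of `x` equal to `.inr b`. -/
def cnt (b : Bool) (x : Fin k → Fin m ⊕ Bool) : ℕ := #{j | x j = .inr b}

/-- `S` contains all but a tolerable number of coordinates of `x`. -/
def Near (x : Fin k → Fin m ⊕ Bool) (S : Finset (Fin m)) : Prop := outs S x ≤ tolerance S

lemma Near.inter {x : Fin k → Fin m ⊕ Bool} {S T : Finset (Fin m)} (hS : Near x S)
    (hT : Near x T) : Near x (S ∩ T) := by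
  by_cases h1 : S ⊆ T
  · rwa [Finset.inter_eq_left.2 h1]
  by_cases h2 : T ⊆ S
  · rwa [Finset.inter_eq_right.2 h2]
  have hvS := two_mul_tolerance_le (binVal_lt (Finset.ssubset_iff_subset_ne.2
    ⟨Finset.inter_subset_left (s₁ := S) (s₂ := T), fun h => h1 (Finset.inter_eq_left.1 h)⟩))
  have hvT := two_mul_tolerance_le (binVal_lt (Finset.ssubset_iff_subset_ne.2
    ⟨Finset.inter_subset_right (s₁ := S) (s₂ := T), fun h => h2 (Finset.inter_eq_right.1 h)⟩))
  have ho : outs (S ∩ T) x ≤ outs S x + outs T x := by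
    refine le_trans (Finset.card_le_card ?_) (Finset.card_union_le _ _)
    intro j
    simp only [Finset.mem_filter, Finset.mem_univ, true_and, Finset.mem_union, Finset.mem_inter]
    intro h
    by_contra! hc
    obtain ⟨⟨s, hs, hxs⟩, t, ht, hxt⟩ := hc
    obtain rfl : s = t := Sum.inl_injective (hxs.symm.trans hxt)
    exact h s ⟨hs, ht⟩ hxs
  unfold Near at *
  omega

/-- `P` is the least set near `x`. -/
def IsCore (x : Fin k → Fin m ⊕ Bool) (P : Finset (Fin m)) : Prop :=
  Near x P ∧ ∀ S, Near x S → P ⊆ S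

lemma exists_isCore {x : Fin k → Fin m ⊕ Bool} (h : ∃ S, Near x S) : ∃ P, IsCore x P := by
  obtain ⟨P, hP, hmin⟩ := exists_minimal_of_wellFoundedLT (Near x) h
  exact ⟨P, hP, fun S hS => (hmin (hP.inter hS) Finset.inter_subset_left).trans
    Finset.inter_subset_right⟩

/-- `e` is the least element of the least set near `x`. -/
def IsVal (x : Fin k → Fin m ⊕ Bool) (e : Fin m) : Prop :=
  ∃ P, IsCore x P ∧ e ∈ P ∧ ∀ j ∈ P, e ≤ j

lemma IsVal.unique {x : Fin k → Fin m ⊕ Bool} {e e' : Fin m} (h : IsVal x e)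
    (h' : IsVal x e') : e = e' := by
  obtain ⟨P, hP, he, hmin⟩ := h
  obtain ⟨Q, hQ, he', hmin'⟩ := h'
  obtain rfl : P = Q := (hP.2 _ hQ.1).antisymm (hQ.2 _ hP.1)
  exact le_antisymm (hmin _ he') (hmin' _ he)

lemma IsVal.exists_eq {x : Fin k → Fin m ⊕ Bool} {e : Fin m} (h : IsVal x e) :
    ∃ j, x j = .inl e := by
  obtain ⟨P, hP, he, -⟩ := h
  by_contra! hx
  have hn : Near x (P.erase e) := by
    refine le_trans ?_ (hP.1.trans (tolerance_anti (Finset.erase_subset e P)))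
    refine Finset.card_le_card fun j => ?_
    simp only [Finset.mem_filter, Finset.mem_univ, true_and, Finset.mem_erase]
    intro hj s hs
    by_cases hse : s = e
    · exact hse ▸ hx j
    · exact hj s ⟨hse, hs⟩
  exact Finset.notMem_erase e P (hP.2 _ hn he)

lemma exists_isVal {x : Fin k → Fin m ⊕ Bool} (hk : tolerance (∅ : Finset (Fin m)) < k)
    (h : ∃ S, Near x S) : ∃ e, IsVal x e := by
  obtain ⟨P, hP⟩ := exists_isCore h
  have hne : P.Nonempty := by
    rw [Finset.nonempty_iff_ne_empty]
    rintro rfl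
    have := hP.1
    simp only [Near, outs, Finset.notMem_empty, false_imp_iff, implies_true, Finset.filter_true,
      Finset.card_univ, Fintype.card_fin] at this
    omega
  exact ⟨P.min' hne, P, hP, P.min'_mem hne, fun j hj => P.min'_le j hj⟩

open Classical in
/-- The near-unanimity operation: the least element of the least set near `x` if there is one,
otherwise the more frequent of the two elements outside `Fin m`. -/
noncomputable def nuOp (x : Fin k → Fin m ⊕ Bool) : Fin m ⊕ Bool :=
  if h : ∃ e, IsVal x e then .inl h.choose else .inr (decide (cnt false x < cnt true x))

lemma nuOp_eq_inl_iff {x : Fin k → Fin m ⊕ Bool} {e : Fin m} :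
    nuOp x = .inl e ↔ IsVal x e := by
  unfold nuOp
  split_ifs with h
  · constructor
    · intro he
      exact Sum.inl_injective he ▸ h.choose_spec
    · intro he
      rw [h.choose_spec.unique he]
  · simpa using fun he => h ⟨e, he⟩

lemma nuOp_eq_inr {x : Fin k → Fin m ⊕ Bool} (h : ∀ e, ¬ IsVal x e) {b : Bool}
    (hb : cnt (!b) x < cnt b x) : nuOp x = .inr b := by
  unfold nuOp
  rw [dif_neg (by simpa using h)]
  cases b
  · simpa using hb.le
  · simpa using hb

lemma isNU_nuOp (hk : tolerance (∅ : Finset (Fin m)) + 3 ≤ k) :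
    IsNU (nuOp : (Fin k → Fin m ⊕ Bool) → Fin m ⊕ Bool) := by
  have hcompl : ∀ (S : Finset (Fin k)) (j : Fin k), ({j}ᶜ : Finset (Fin k)) ⊆ S → k ≤ #S + 1 := by
    intro S j h
    have := Finset.card_le_card h
    rw [Finset.card_compl, Finset.card_singleton, Fintype.card_fin] at this
    omega
  have hfar : ∀ (x y : Fin m ⊕ Bool) (j : Fin k) (S : Finset (Fin m)), (∀ s ∈ S, x ≠ .inl s) →
      ¬ Near (Function.update (fun _ => x) j y) S := by
    intro x y j S hS hn
    have h1 := hcompl {l | ∀ s ∈ S, Function.update (fun _ => x) j y l ≠ .inl s} j (by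
      intro l hl
      have hl : l ≠ j := by simpa using hl
      simpa [hl] using hS)
    have h2 := tolerance_anti (Finset.empty_subset S)
    unfold Near outs at hn
    omega
  refine ⟨by omega, fun x y j => ?_⟩
  rcases x with e | b
  · refine nuOp_eq_inl_iff.2 ⟨{e}, ⟨?_, fun S hS => ?_⟩, by simp, by simp⟩
    · refine le_trans ?_ (one_le_tolerance _)
      rw [← Finset.card_singleton j]
      refine Finset.card_le_card fun l hl => ?_
      by_contra hlj
      have hlj : l ≠ j := by simpa using hlj
      simp [hlj] at hl
    · rw [Finset.singleton_subset_iff]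
      by_contra he
      refine hfar _ _ _ S (fun s hs h => ?_) hS
      cases h
      exact he hs
  · apply nuOp_eq_inr
    · rintro e ⟨P, hP, -⟩
      exact hfar _ _ _ P (by simp) hP.1
    · have h1 := hcompl {l | Function.update (fun _ => (.inr b : Fin m ⊕ Bool)) j y l = .inr b} j (by
        intro l hl
        have hl : l ≠ j := by simpa using hl
        simp [hl])
      have h2 : cnt (!b) (Function.update (fun _ => (.inr b : Fin m ⊕ Bool)) j y) ≤ 1 := by
        rw [← Finset.card_singleton j]
        refine Finset.card_le_card fun l hl => ?_
        by_contra hlj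
        have hlj : l ≠ j := by simpa using hlj
        simp [hlj] at hl
      unfold cnt at *
      omega

section Step

variable {i : Fin m} {b : Bool} {x y : Fin k → Fin m ⊕ Bool}

lemma near_iff_of_step (h : ∀ j, Step i b (x j) (y j)) {Q : Finset (Fin m)}
    (hQ : ∀ q ∈ Q, i < q) : Near x Q ↔ Near y Q := by
  have hxy : ∀ j, ∀ q, i < q → (x j = .inl q ↔ y j = .inl q) := by
    intro j q hq
    rcases h j with ⟨e, he, hx, hy⟩ | ⟨hx, ⟨l, hl, hy⟩ | hy⟩ | ⟨⟨c, hx⟩, ⟨l, hl, hy⟩ | ⟨c', hy⟩⟩ <;>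
    grind
  have : outs Q x = outs Q y := by
    unfold outs
    congr 1
    ext j
    simp only [Finset.mem_filter, Finset.mem_univ, true_and]
    exact forall₂_congr fun q hq => not_congr (hxy j q (hQ q hq))
  rw [Near, Near, this]

lemma nuOp_eq_inr_of_step (hk : tolerance (∅ : Finset (Fin m)) < k)
    (h : ∀ j, Step i b (x j) (y j)) (hx : IsVal x i) (hy : ∀ e, ¬ IsVal y e) :
    nuOp y = .inr b := by
  obtain ⟨P, hP, hi, hmin⟩ := hx
  apply nuOp_eq_inr hy
  have hlt : binVal (decr P i) < binVal P := by
    have := binVal_decr hi hmin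
    omega
  have htol := two_mul_tolerance_le hlt
  have hfar : tolerance (decr P i) < outs (decr P i) y := by
    by_contra hn
    obtain ⟨e, he⟩ := exists_isVal hk ⟨_, not_lt.1 hn⟩
    exact hy e he
  have hstep : ∀ j, (∃ s ∈ P, x j = .inl s) →
      (∃ s ∈ decr P i, y j = .inl s) ∨ y j = .inr b := by
    rintro j ⟨s, hs, hxs⟩
    simp only [decr, Finset.mem_union, Finset.mem_erase, Finset.mem_Iio]
    rcases h j with ⟨e, he, hx, hy⟩ | ⟨hx, ⟨l, hl, hy⟩ | hy⟩ | ⟨⟨c, hx⟩, -⟩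
    · obtain rfl : s = e := Sum.inl_injective (hxs.symm.trans hx)
      exact .inl ⟨s, .inl ⟨he.ne', hs⟩, hy⟩
    · exact .inl ⟨l, .inr hl, hy⟩
    · exact .inr hy
    · simp [hx] at hxs
  have hout : outs (decr P i) y ≤ outs P x + cnt b y := by
    refine le_trans (Finset.card_le_card ?_) (Finset.card_union_le _ _)
    intro j
    simp only [Finset.mem_filter, Finset.mem_univ, true_and, Finset.mem_union]
    intro hj
    by_contra! hc
    rcases hstep j hc.1 with ⟨s, hs, hys⟩ | hb
    · exact hj s hs hys
    · exact hc.2 hb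
  have hcnt : cnt (!b) y ≤ outs P x := by
    refine Finset.card_le_card fun j => ?_
    simp only [Finset.mem_filter, Finset.mem_univ, true_and]
    intro hj
    by_contra! hc
    rcases hstep j hc with ⟨s, hs, hys⟩ | hb
    · simp [hj] at hys
    · simp [hj] at hb
  have := hP.1
  unfold Near at this
  omega

lemma step_nuOp (hk : tolerance (∅ : Finset (Fin m)) < k) (h : ∀ j, Step i b (x j) (y j)) :
    Step i b (nuOp x) (nuOp y) := by
  have hyi : ∀ q, nuOp y = .inl q → q ≠ i := by
    rintro q hq rfl
    obtain ⟨j, hj⟩ := (nuOp_eq_inl_iff.1 hq).exists_eq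
    rcases h j with ⟨e, he, hx, hy⟩ | ⟨hx, ⟨l, hl, hy⟩ | hy⟩ | ⟨⟨c, hx⟩, ⟨l, hl, hy⟩ | ⟨c', hy⟩⟩ <;>
    simp only [hy, Sum.inl.injEq, reduceCtorEq] at hj <;> omega
  have hcore : ∀ q, nuOp y = .inl q → ¬ q < i → ∃ Q, (∀ l ∈ Q, i < l) ∧ IsCore y Q ∧ Near x Q := by
    intro q hq hqi
    obtain ⟨Q, hQ, hqQ, hmin⟩ := nuOp_eq_inl_iff.1 hq
    have hlt : ∀ l ∈ Q, i < l := fun l hl =>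
      lt_of_lt_of_le (lt_of_le_of_ne (not_lt.1 hqi) (hyi q hq).symm) (hmin l hl)
    exact ⟨Q, hlt, hQ, (near_iff_of_step h hlt).2 hQ.1⟩
  rcases hx : nuOp x with e | c
  · have hval := nuOp_eq_inl_iff.1 hx
    obtain ⟨j, hj⟩ := hval.exists_eq
    have hie : i ≤ e := by
      rcases h j with ⟨e', he, hx, -⟩ | ⟨hx, -⟩ | ⟨⟨c, hx⟩, -⟩ <;>
      simp only [hx, Sum.inl.injEq, reduceCtorEq] at hj <;> omega
    rcases hie.eq_or_lt with rfl | hlt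
    · refine .inr (.inl ⟨rfl, ?_⟩)
      rcases hy : nuOp y with q | c
      · refine .inl ⟨q, ?_, rfl⟩
        by_contra hq
        obtain ⟨Q, hQ, -, hn⟩ := hcore q hy hq
        obtain ⟨P, hP, hi, -⟩ := hval
        exact lt_irrefl _ (hQ _ (hP.2 Q hn hi))
      · refine .inr ?_
        rw [← hy]
        refine nuOp_eq_inr_of_step hk h hval fun e he => ?_
        rw [nuOp_eq_inl_iff.2 he] at hy
        simp at hy
    · refine .inl ⟨e, hlt, rfl, ?_⟩
      obtain ⟨P, hP, he, hmin⟩ := hval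
      have hPi : ∀ l ∈ P, i < l := fun l hl => hlt.trans_le (hmin l hl)
      refine nuOp_eq_inl_iff.2 ⟨P, ⟨(near_iff_of_step h hPi).1 hP.1, ?_⟩, he, hmin⟩
      intro S hS
      have hPS := ((near_iff_of_step h hPi).1 hP.1).inter hS
      exact (hP.2 _ ((near_iff_of_step h fun l hl =>
        hPi l (Finset.mem_of_mem_inter_left hl)).2 hPS)).trans Finset.inter_subset_right
  · refine .inr (.inr ⟨⟨c, rfl⟩, ?_⟩)
    rcases hy : nuOp y with q | c'
    · refine .inl ⟨q, ?_, rfl⟩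
      by_contra hq
      obtain ⟨Q, -, -, hn⟩ := hcore q hy hq
      obtain ⟨e, he⟩ := exists_isVal hk ⟨Q, hn⟩
      rw [nuOp_eq_inl_iff.2 he] at hx
      simp at hx
    · exact .inr ⟨c', rfl⟩

end Step

end Construction

end NUCounter

/-- For every `n ≥ 3` there is a relational structure on an `n`-element set with
relations of arity at most `2` that admits an NU polymorphism but none of
arity `≤ 2^(2^(n-3))`. -/
theorem stmt1 (n : ℕ) (hn : 3 ≤ n) :
    ∃ (A : Type) (inst : Fintype A) (I : Type) (r : I → ℕ)
      (R : (i : I) → Set (Fin (r i) → A)),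
      @Fintype.card A inst = n ∧ (∀ i, r i ≤ 2) ∧
      (∃ (k : ℕ) (f : (Fin k → A) → A), IsNU f ∧ ∀ i, Compat f (R i)) ∧
      (∀ (k : ℕ) (f : (Fin k → A) → A), k ≤ 2 ^ 2 ^ (n - 3) → IsNU f →
        ¬ (∀ i, Compat f (R i))) := by
  obtain ⟨m, rfl⟩ : ∃ m, n = m + 2 := ⟨n - 2, by omega⟩
  refine ⟨Fin m ⊕ Bool, inferInstance, Fin m × Bool, fun _ => 2, NUCounter.stepRel, by simp,
    fun _ => le_rfl, ⟨NUCounter.tolerance (∅ : Finset (Fin m)) + 3, NUCounter.nuOp,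
      NUCounter.isNU_nuOp le_rfl, fun p u hu => ?_⟩, fun k f hk hNU => ?_⟩
  · exact NUCounter.step_nuOp (by omega) hu
  · refine NUCounter.not_compat_of_le (by omega) ?_ hNU
    rwa [show m - 1 = m + 2 - 3 by omega]
end

section
/- The structure 𝔅 admits a near-unanimity polymorphism of arity 2^{2^n}+1, but admits no near-unanimity polymorphism of arity k for any k with 3 ≤ k ≤ 2^{2^n}. -/
/- The universe `B = {a₁, a₂, 0, 1, ..., n}` of size `n+3` is encoded as
`Fin (n+3)`, where `a₁` is encoded as `0`, `a₂` as `1`, and the element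
`i ∈ {0, ..., n}` as `i+2`; this encoding is order-preserving for the order
`a₁ < a₂ < 0 < 1 < ⋯ < n`. -/

/-- Compatibility with a binary relation, given as a set of pairs. -/
def Compat2 {A : Type*} {k : ℕ} (t : (Fin k → A) → A) (S : Set (A × A)) : Prop :=
  ∀ u w : Fin k → A, (∀ j, (u j, w j) ∈ S) → (t u, t w) ∈ S

/-- Compatibility with a unary relation `X`: `t` maps `X^k` into `X`. -/
def CompatUnary {A : Type*} {k : ℕ} (t : (Fin k → A) → A) (X : Set A) : Prop :=
  ∀ u : Fin k → A, (∀ j, u j ∈ X) → t u ∈ X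

/-- The binary relation `R^i_j ⊆ B²` (for `i ∈ {0,…,n}`, `j ∈ {1,2}`):
`(({a₁,a₂,0,…,i-1} × {a₁,a₂,i}) \ {(a_j, i)}) ∪ {(l,l) : i+1 ≤ l ≤ n}`.
In the encoding: the first coordinate has value `≤ i+1`, the second has value `0`,
`1` or `i+2`, excluding the pair `(j-1, i+2)`; the diagonal pairs have value `≥ i+3`. -/
def Rb (n i j : ℕ) : Set (Fin (n + 3) × Fin (n + 3)) :=
  {p | (p.1.val ≤ i + 1 ∧ (p.2.val = 0 ∨ p.2.val = 1 ∨ p.2.val = i + 2) ∧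
          ¬(p.1.val = j - 1 ∧ p.2.val = i + 2)) ∨
        (p.1 = p.2 ∧ i + 3 ≤ p.1.val)}

/-- A polymorphism of the structure `𝔅 = (B; R¹₁, R¹₂, …, Rⁿ₁, Rⁿ₂, (X)_{∅ ≠ X ⊆ B})`:
an operation compatible with each `R^i_j` and with every nonempty unary relation. -/
def PolyB (n : ℕ) {k : ℕ} (t : (Fin k → Fin (n + 3)) → Fin (n + 3)) : Prop :=
  (∀ i ≤ n, ∀ j, (j = 1 ∨ j = 2) → Compat2 t (Rb n i j)) ∧
  (∀ X : Set (Fin (n + 3)), X.Nonempty → CompatUnary t X)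

/-! ### Nonexistence of near-unanimity polymorphisms of small arity -/

/-- Replace every entry of `u` coding one of the elements `0, …, s - 1` by `a₂`. -/
def collapse {k n : ℕ} (s : ℕ) (u : Fin k → Fin (n + 3)) : Fin k → Fin (n + 3) :=
  fun l => if 2 ≤ (u l).val ∧ (u l).val < s + 2 then 1 else u l

theorem apply_collapse {n k : ℕ} {t : (Fin k → Fin (n + 3)) → Fin (n + 3)}
    (ht : ∀ i ≤ n, ∀ j, (j = 1 ∨ j = 2) → Compat2 t (Rb n i j))
    (u : Fin k → Fin (n + 3)) (s : ℕ) (hs : s + 2 ≤ (t u).val) :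
    t (collapse s u) = t u := by
  induction s with
  | zero =>
    congr 1
    funext l
    simp only [collapse]
    rw [if_neg (by omega)]
  | succ s ih =>
    have ih := ih (by omega)
    have hlt := (t u).isLt
    have h := ht s (by omega) 1 (Or.inl rfl) (collapse (s + 1) u) (collapse s u) (by
      intro l
      have h1 : (1 : Fin (n + 3)).val = 1 := rfl
      simp only [Rb, collapse, Set.mem_ofPred_eq, Fin.ext_iff]
      split_ifs <;> omega)
    rw [ih] at h
    simp only [Rb, Set.mem_ofPred_eq] at h
    rcases h with h | h
    · omega
    · exact h.1

theorem not_forall_few_distinguished {n k : ℕ} {t : (Fin k → Fin (n + 3)) → Fin (n + 3)}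
    (ht : ∀ i ≤ n, ∀ j, (j = 1 ∨ j = 2) → Compat2 t (Rb n i j)) (i : ℕ) (hi : i ≤ n)
    (c : ℕ) (M : Finset (Fin k)) (v : Fin k → Fin (n + 3))
    (hv : ∀ l ∉ M, i + 2 ≤ (v l).val) (hM : M.card ≤ 2 ^ 2 ^ i * c) :
    ¬ ∀ u : Fin k → Fin (n + 3), (∀ l ∉ M, u l = v l) → (∀ l ∈ M, (u l).val < i + 2) →
      (∀ j < 2, (M.filter fun l => (u l).val = j).card ≤ c) →
      2 ≤ (t u).val ∧ (t u).val < i + 2 := by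
  induction i generalizing c M v with
  | zero =>
    intro H
    obtain ⟨P, hPM, hP⟩ := Finset.exists_subset_card_eq (s := M) (n := M.card / 2) (by omega)
    have hsd := Finset.card_sdiff_of_subset hPM
    norm_num at hM
    have := H (fun l => if l ∈ P then 0 else if l ∈ M then 1 else v l)
      (fun l hl => by
        have : l ∉ P := fun h => hl (hPM h)
        simp [hl, this])
      (fun l hl => by
        have h1 : (1 : Fin (n + 3)).val = 1 := rfl
        simp only [hl, if_true]
        split_ifs <;> simp)
      (fun j hj => by
        have h1 : (1 : Fin (n + 3)).val = 1 := rfl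
        interval_cases j
        · refine (Finset.card_le_card (t := P) fun l hl => ?_).trans (by omega)
          simp only [Finset.mem_filter] at hl
          by_contra h
          simp [hl.1, h] at hl
        · refine (Finset.card_le_card (t := M \ P) fun l hl => ?_).trans (by omega)
          simp only [Finset.mem_filter, Finset.mem_sdiff] at hl ⊢
          refine ⟨hl.1, fun h => ?_⟩
          simp [h] at hl)
    omega
  | succ i ih =>
    intro H
    have win : ∀ N ⊆ M, N.card ≤ 2 ^ 2 ^ i * c → ∃ w : Fin k → Fin (n + 3),
        (∀ l ∉ M, w l = v l) ∧ (∀ l ∈ M, l ∉ N → (w l).val = i + 2) ∧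
        (∀ l ∈ N, (w l).val < 2) ∧ (t w).val = i + 2 := by
      intro N hNM hN
      have h := ih (by omega) c N (fun l => if l ∈ M then ⟨i + 2, by omega⟩ else v l)
        (fun l hl => by
          split_ifs with h
          · exact le_rfl
          · have := hv l h
            omega) hN
      push Not at h
      obtain ⟨u, hu1, hu2, hu3, hu4⟩ := h
      have huM : ∀ l ∉ M, u l = v l := fun l hl => by
        rw [hu1 l fun h => hl (hNM h), if_neg hl]
      have huN : ∀ l ∈ M, l ∉ N → (u l).val = i + 2 := fun l hl h => by
        rw [hu1 l h, if_pos hl]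
      have htu := H u huM
        (fun l hl => by
          by_cases h : l ∈ N
          · have := hu2 l h
            omega
          · rw [huN l hl h]
            omega)
        (fun j hj => by
          refine (Finset.card_le_card fun l hl => ?_).trans (hu3 j hj)
          rw [Finset.mem_filter] at hl ⊢
          refine ⟨?_, hl.2⟩
          by_contra h
          have := huN l hl.1 h
          omega)
      have htu' := hu4 htu.1
      have hval : (t u).val = i + 2 := by omega
      refine ⟨collapse i u, fun l hl => ?_, fun l hl h => ?_, fun l hl => ?_, ?_⟩
      · have := hv l hl
        rw [← huM l hl] at this ⊢
        exact if_neg (by omega)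
      · have := huN l hl h
        unfold collapse
        rw [if_neg (by omega), this]
      · have := hu2 l hl
        have h1 : (1 : Fin (n + 3)).val = 1 := rfl
        unfold collapse
        split_ifs <;> omega
      · rw [apply_collapse ht u i hval.ge, hval]
    refine ih (by omega) (2 ^ 2 ^ i * c) M v (fun l hl => by have := hv l hl; omega)
      (by rw [← mul_assoc, ← pow_add, ← mul_two, ← pow_succ]; exact hM) ?_
    intro u hu1 hu2 hu3
    have key : ∀ j < 2, (t u).val < i + 2 ∧ (t u).val ≠ j := by
      intro j hj
      obtain ⟨w, hw1, hw2, hw3, hw4⟩ := win _ (Finset.filter_subset _ M) (hu3 j hj)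
      have h := ht i (by omega) (j + 1) (by omega) u w (by
        intro l
        simp only [Rb, Set.mem_ofPred_eq]
        by_cases hl : l ∈ M
        · have h2 := hu2 l hl
          by_cases hlj : (u l).val = j
          · have := hw3 l (by simp [hl, hlj])
            omega
          · have := hw2 l hl (by simp [hlj])
            omega
        · right
          rw [hu1 l hl, hw1 l hl]
          have := hv l hl
          exact ⟨rfl, by omega⟩)
      simp only [Rb, Set.mem_ofPred_eq] at h
      rcases h with h | ⟨h1, h2⟩
      · omega
      · rw [h1] at h2
        omega
    have h0 := key 0 (by omega)
    have h1 := key 1 (by omega)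
    omega

theorem not_isNU_of_le {n k : ℕ} {t : (Fin k → Fin (n + 3)) → Fin (n + 3)}
    (ht : ∀ i ≤ n, ∀ j, (j = 1 ∨ j = 2) → Compat2 t (Rb n i j)) (hk : k ≤ 2 ^ 2 ^ n) :
    ¬ IsNU t := by
  rintro ⟨hk3, hNU⟩
  refine not_forall_few_distinguished ht n le_rfl 1 Finset.univ (fun _ => 0) (by simp)
    (by simpa using hk) fun u _ hu2 hu3 => ?_
  have key : ∀ j < 2, (t u).val < n + 2 ∧ (t u).val ≠ j := by
    intro j hj
    obtain ⟨p, hp⟩ : ∃ p, ∀ l, (u l).val = j → l = p := by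
      by_cases h : ∃ p, (u p).val = j
      · obtain ⟨p, hp⟩ := h
        exact ⟨p, fun l hl => Finset.card_le_one.1 (hu3 j hj) l (by simp [hl]) p (by simp [hp])⟩
      · exact ⟨⟨0, by omega⟩, fun l hl => (h ⟨l, hl⟩).elim⟩
    have h := ht n le_rfl (j + 1) (by omega) u (Function.update (fun _ => Fin.last (n + 2)) p 0) (by
      intro l
      have := hu2 l (Finset.mem_univ l)
      simp only [Rb, Set.mem_ofPred_eq]
      by_cases hl : l = p
      · subst hl
        simp
        omega
      · have : (u l).val ≠ j := fun h => hl (hp l h)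
        simp [Function.update_of_ne hl]
        omega)
    rw [hNU] at h
    simp only [Rb, Set.mem_ofPred_eq, Fin.val_last, and_true, or_true, true_and] at h
    rcases h with h | ⟨h1, h2⟩
    · omega
    · rw [h1, Fin.val_last] at h2
      omega
  have h0 := key 0 (by omega)
  have h1 := key 1 (by omega)
  omega

/-! ### A near-unanimity polymorphism of arity `2 ^ 2 ^ n + 1` -/

section Vote

variable {ι : Type*} [Fintype ι]

/-- The winner among the entries of `u` of value less than `i + 2`, where `c` bounds the weight
(each entry having weight `s`) of values that must not win. -/
def vote (s : ℕ) : ℕ → ℕ → (ι → ℕ) → ℕ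
  | 0, _, u => if Fintype.card {l // u l = 1} ≤ Fintype.card {l // u l = 0} then 0 else 1
  | i + 1, c, u =>
    if ∀ l, u l ≠ i + 2 then vote s i (2 ^ 2 ^ i * c) u
    else if s * Fintype.card {l // u l < i + 2} ≤ 2 ^ 2 ^ i * c then i + 2
    else vote s i c u

theorem card_lt_succ (u : ι → ℕ) (a : ℕ) :
    Fintype.card {l // u l < a + 1} = Fintype.card {l // u l < a} + Fintype.card {l // u l = a} := by
  classical
  rw [← Fintype.card_subtype_or_disjoint]
  · exact Fintype.card_congr (Equiv.subtypeEquivRight fun l => by omega)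
  · rw [Pi.disjoint_iff]
    intro l
    rw [Prop.disjoint_iff]
    by_contra h
    omega

theorem card_lt_succ_of_forall_ne {u : ι → ℕ} {a : ℕ} (h : ∀ l, u l ≠ a) :
    Fintype.card {l // u l < a + 1} = Fintype.card {l // u l < a} :=
  Fintype.card_congr (Equiv.subtypeEquivRight fun l => by have := h l; omega)

theorem two_pow_two_pow_succ_mul (i c : ℕ) :
    2 ^ 2 ^ (i + 1) * c = 2 ^ 2 ^ i * (2 ^ 2 ^ i * c) := by
  rw [← mul_assoc, ← pow_add, ← mul_two, ← pow_succ]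

theorem vote_mem {s i c : ℕ} {u : ι → ℕ}
    (h : 2 ^ 2 ^ i * c < s * Fintype.card {l // u l < i + 2}) :
    ∃ l, u l = vote s i c u ∧ u l < i + 2 := by
  induction i generalizing c with
  | zero =>
    have e2 := card_lt_succ u 1
    have e1 := card_lt_succ u 0
    have e0 : Fintype.card {l // u l < 0} = 0 := by simp
    have hpos : 0 < Fintype.card {l // u l < 0 + 2} := by
      by_contra h0
      rw [Nat.eq_zero_of_not_pos h0] at h
      omega
    simp only [Nat.reduceAdd] at *
    unfold vote
    split_ifs with hc
    · obtain ⟨⟨l, hl⟩⟩ := Fintype.card_pos_iff.1 (by omega : 0 < Fintype.card {l // u l = 0})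
      exact ⟨l, by omega⟩
    · obtain ⟨⟨l, hl⟩⟩ := Fintype.card_pos_iff.1 (by omega : 0 < Fintype.card {l // u l = 1})
      exact ⟨l, by omega⟩
  | succ i ih =>
    unfold vote
    split_ifs with h1 h2
    · rw [two_pow_two_pow_succ_mul, card_lt_succ_of_forall_ne (a := i + 2) h1] at h
      obtain ⟨l, hl⟩ := ih h
      exact ⟨l, hl.1, by omega⟩
    · push Not at h1
      obtain ⟨l, hl⟩ := h1
      exact ⟨l, hl, by omega⟩
    · obtain ⟨l, hl⟩ := ih (not_le.1 h2)
      exact ⟨l, hl.1, by omega⟩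

theorem vote_ne {s i c : ℕ} {u : ι → ℕ}
    (h : 2 ^ 2 ^ i * c < s * Fintype.card {l // u l < i + 2}) {y : ℕ}
    (hy : s * Fintype.card {l // u l = y} ≤ c) : vote s i c u ≠ y := by
  induction i generalizing c with
  | zero =>
    have e2 := card_lt_succ u 1
    have e1 := card_lt_succ u 0
    have e0 : Fintype.card {l // u l < 0} = 0 := by simp
    simp only [Nat.reduceAdd] at *
    rw [e2, e1, e0] at h
    norm_num at h
    unfold vote
    split_ifs with hc
    · rintro rfl
      have := Nat.mul_le_mul_left s hc
      linarith
    · rintro rfl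
      have := Nat.mul_le_mul_left s (not_le.1 hc).le
      linarith
  | succ i ih =>
    have hcx : c ≤ 2 ^ 2 ^ i * c := Nat.le_mul_of_pos_left _ (by positivity)
    unfold vote
    split_ifs with h1 h2
    · rw [two_pow_two_pow_succ_mul, card_lt_succ_of_forall_ne (a := i + 2) h1] at h
      exact ih h (hy.trans hcx)
    · rintro rfl
      rw [two_pow_two_pow_succ_mul, show i + 1 + 2 = i + 2 + 1 by omega, card_lt_succ] at h
      have h2i : 2 ≤ 2 ^ 2 ^ i := Nat.le_self_pow (by positivity) 2
      have := Nat.mul_le_mul_right (2 ^ 2 ^ i * c) h2i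
      linarith
    · exact ih (not_le.1 h2) hy

/-- The relation `Rb n i j` on codes. -/
def RbVal (i j a b : ℕ) : Prop :=
  (a ≤ i + 1 ∧ (b = 0 ∨ b = 1 ∨ b = i + 2) ∧ ¬(a = j - 1 ∧ b = i + 2)) ∨ (a = b ∧ i + 3 ≤ a)

theorem mem_Rb_iff {n i j : ℕ} {a b : Fin (n + 3)} : (a, b) ∈ Rb n i j ↔ RbVal i j a b := by
  simp only [Rb, RbVal, Set.mem_ofPred_eq, Fin.ext_iff]

theorem vote_compat {s i j m c : ℕ} {u w : ι → ℕ} (huw : ∀ l, RbVal i j (u l) (w l))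
    (hm : i + 1 ≤ m) (h : 2 ^ 2 ^ m * c < s * Fintype.card {l // u l < m + 2}) :
    RbVal i j (vote s m c u) (vote s m c w) := by
  unfold RbVal at huw
  have hcard : ∀ m, i + 1 ≤ m →
      Fintype.card {l // u l < m + 2} = Fintype.card {l // w l < m + 2} := fun m hm =>
    Fintype.card_congr (Equiv.subtypeEquivRight fun l => by have := huw l; omega)
  induction m, hm using Nat.le_induction generalizing c with
  | base =>
    have hw := hcard (i + 1) le_rfl ▸ h
    have hu2 : ∀ l, u l ≠ i + 2 := fun l => by have := huw l; omega
    have hu : 2 ^ 2 ^ i * (2 ^ 2 ^ i * c) < s * Fintype.card {l // u l < i + 2} := by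
      rwa [two_pow_two_pow_succ_mul, card_lt_succ_of_forall_ne (a := i + 2) hu2] at h
    have hvu : vote s (i + 1) c u = vote s i (2 ^ 2 ^ i * c) u := by
      rw [vote, if_pos hu2]
    obtain ⟨p, hp, hp'⟩ := vote_mem hu
    obtain ⟨q, hq, hq'⟩ := vote_mem hw
    left
    refine ⟨by omega, by have := huw q; omega, ?_⟩
    rintro ⟨ha, hb⟩
    rw [hvu] at ha
    have hle : Fintype.card {l // u l = j - 1} ≤ Fintype.card {l // w l < i + 2} :=
      Fintype.card_subtype_mono _ _ fun l hl => by
        have := huw l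
        omega
    rw [vote] at hb
    split_ifs at hb with h1 h2
    · rw [two_pow_two_pow_succ_mul, card_lt_succ_of_forall_ne (a := i + 2) h1] at hw
      obtain ⟨l, hl⟩ := vote_mem hw
      omega
    · exact vote_ne hu ((Nat.mul_le_mul_left s hle).trans h2) ha
    · obtain ⟨l, hl⟩ := vote_mem (not_le.1 h2)
      omega
  | succ m hm ih =>
    have hiff : (∀ l, u l ≠ m + 2) ↔ ∀ l, w l ≠ m + 2 :=
      forall_congr' fun l => by have := huw l; omega
    rw [vote, vote, ← hcard m hm]
    by_cases h1 : ∀ l, u l ≠ m + 2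
    · rw [if_pos h1, if_pos (hiff.1 h1)]
      rw [two_pow_two_pow_succ_mul, card_lt_succ_of_forall_ne (a := m + 2) h1] at h
      exact ih h
    · rw [if_neg h1, if_neg (mt hiff.2 h1)]
      split_ifs with h2
      · exact Or.inr ⟨rfl, by omega⟩
      · exact ih (not_le.1 h2)

end Vote

theorem inv_top {n : ℕ} {u : Fin (2 ^ 2 ^ n + 1) → ℕ} (hu : ∀ l, u l < n + 3) :
    2 ^ 2 ^ (n + 1) * 1 < 2 ^ 2 ^ n * Fintype.card {l // u l < n + 1 + 2} := by
  rw [Fintype.card_congr (Equiv.subtypeUnivEquiv fun l => hu l), Fintype.card_fin,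
    two_pow_two_pow_succ_mul, mul_one]
  exact Nat.mul_lt_mul_of_pos_left (by omega) (by positivity)

theorem vote_nearUnanimous {n x : ℕ} {u : Fin (2 ^ 2 ^ n + 1) → ℕ} (hu : ∀ l, u l < n + 3)
    (p : Fin (2 ^ 2 ^ n + 1)) (hx : ∀ l ≠ p, u l = x) : vote (2 ^ 2 ^ n) (n + 1) 1 u = x := by
  have htop := inv_top hu
  by_contra hne
  have hval : vote (2 ^ 2 ^ n) (n + 1) 1 u = u p := by
    obtain ⟨l, hl, -⟩ := vote_mem htop
    by_cases hlp : l = p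
    · rw [← hl, hlp]
    · exact (hne (by rw [← hl, hx l hlp])).elim
  have hone : ∀ q : ℕ → Prop, [DecidablePred q] → ¬ q x →
      Fintype.card {l // q (u l)} ≤ 1 := fun q _ hq =>
    Fintype.card_le_one_iff_subsingleton.2 ⟨fun a b => by
      have : ∀ a : {l // q (u l)}, a.1 = p := fun a => by
        by_contra h
        exact hq (hx a.1 h ▸ a.2)
      exact Subtype.ext ((this a).trans (this b).symm)⟩
  have hpx : u p ≠ x := fun h => hne (hval.trans h)
  have hs := Nat.mul_le_mul_left (2 ^ 2 ^ n) (hone (· = u p) fun h => hpx h.symm)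
  rw [vote] at hval
  split_ifs at hval with h1 h2
  · rw [two_pow_two_pow_succ_mul, card_lt_succ_of_forall_ne (a := n + 2) h1] at htop
    exact vote_ne htop (by simpa using hs) hval
  · have h3 : 2 ≤ 2 ^ 2 ^ n := Nat.le_self_pow (by positivity) 2
    have h4 := card_lt_succ u (n + 2)
    rw [Fintype.card_congr (Equiv.subtypeUnivEquiv fun l => hu l), Fintype.card_fin] at h4
    have h5 := Nat.le_of_mul_le_mul_left h2 (by positivity)
    have h6 := hone (· = n + 2) (by omega)
    omega
  · obtain ⟨l, hl, hl'⟩ := vote_mem (not_le.1 h2)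
    have hxn : x = n + 2 := by
      push Not at h1
      obtain ⟨q, hq⟩ := h1
      by_cases hqp : q = p
      · subst hqp
        omega
      · rw [← hx q hqp, hq]
    exact h2 (Nat.mul_le_mul_left _ (hone (· < n + 2) (by omega)))

theorem exists_polyB_isNU (n : ℕ) :
    ∃ g : (Fin (2 ^ 2 ^ n + 1) → Fin (n + 3)) → Fin (n + 3), PolyB n g ∧ IsNU g := by
  have hmem : ∀ u : Fin (2 ^ 2 ^ n + 1) → Fin (n + 3),
      ∃ l, (u l).val = vote (2 ^ 2 ^ n) (n + 1) 1 fun l => (u l).val := fun u =>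
    (vote_mem (inv_top fun l => (u l).isLt)).imp fun _ h => h.1
  choose f hf using hmem
  refine ⟨fun u => u (f u), ⟨fun i hi j _ u w huw => ?_, fun X _ u hu => hu _⟩, ?_, ?_⟩
  · have h := vote_compat (i := i) (j := j) (m := n + 1)
      (u := fun l => (u l).val) (w := fun l => (w l).val)
      (fun l => mem_Rb_iff.1 (huw l)) (by omega)
      (inv_top fun l => (u l).isLt)
    rw [← hf u, ← hf w] at h
    exact mem_Rb_iff.2 h
  · have h3 : 2 ≤ 2 ^ 2 ^ n := Nat.le_self_pow (by positivity) 2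
    omega
  · intro x y p
    refine Fin.ext ?_
    rw [hf]
    exact vote_nearUnanimous (fun l => Fin.isLt _) p fun l hl => by
      rw [Function.update_of_ne hl]

/-- The structure `𝔅` admits an NU polymorphism of arity `2^(2^n) + 1`, but no NU
polymorphism of arity `k` for any `3 ≤ k ≤ 2^(2^n)`. -/
theorem stmt19 (n : ℕ) :
    (∃ g : (Fin (2 ^ 2 ^ n + 1) → Fin (n + 3)) → Fin (n + 3),
      PolyB n g ∧ IsNU g) ∧
    (∀ k, 3 ≤ k → k ≤ 2 ^ 2 ^ n →
      ¬ ∃ t : (Fin k → Fin (n + 3)) → Fin (n + 3), PolyB n t ∧ IsNU t) := by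
  exact ⟨exists_polyB_isNU n, fun k _ hk ⟨t, ht, hNU⟩ => not_isNU_of_le ht.1 hk hNU⟩
end
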